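/- Let k_1, …, k_p ≥ 1 and let w ∈ B^{xy}(k_1,…,k_p) with completion ŵ. Then in L(m,n) there are scalars c_1, …, c_t ∈ K and words w_1, …, w_t ∈ B^{xy}(k_1,…,k_p), each of length strictly greater than the length of w, such that ŵ = w + c_1 w_1 + ⋯ + c_t w_t holds in L(m,n). -/

import Mathlib

open scoped BigOperators

/-- Generators of the Leavitt algebra `L(m,n)`: `Sum.inl (i,j)` is the x-letter `x_{ij}`
(`1 ≤ i ≤ m`, `1 ≤ j ≤ n`, written 0-indexed), and `Sum.inr (j,i)` is the y-letter `y_{ji}`. -/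
abbrev LGen (m n : ℕ) := (Fin m × Fin n) ⊕ (Fin n × Fin m)

/-- The defining relations of the Leavitt algebra `L(m,n)`:
`∑_j x_{ij} y_{ji'} = δ_{i,i'}` and `∑_i y_{ji} x_{ij'} = δ_{j,j'}`. -/
inductive LRel (K : Type) [Field K] (m n : ℕ) :
    FreeAlgebra K (LGen m n) → FreeAlgebra K (LGen m n) → Prop
  | xy (i i' : Fin m) :
      LRel K m n
        (∑ j : Fin n, FreeAlgebra.ι K (Sum.inl (i, j)) * FreeAlgebra.ι K (Sum.inr (j, i')))
        (if i = i' then 1 else 0)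
  | yx (j j' : Fin n) :
      LRel K m n
        (∑ i : Fin m, FreeAlgebra.ι K (Sum.inr (j, i)) * FreeAlgebra.ι K (Sum.inl (i, j')))
        (if j = j' then 1 else 0)

/-- The Leavitt algebra `L(m,n)`, presented by the generators `x_{ij}, y_{ji}` and the
relations `∑_j x_{ij} y_{ji'} = δ_{i,i'}`, `∑_i y_{ji} x_{ij'} = δ_{j,j'}`. -/
abbrev Leavitt (K : Type) [Field K] (m n : ℕ) := RingQuot (LRel K m n)

/-- The image of a generator in `L(m,n)`. -/
noncomputable def lgen (K : Type) [Field K] {m n : ℕ} (z : LGen m n) : Leavitt K m n :=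
  RingQuot.mkAlgHom K (LRel K m n) (FreeAlgebra.ι K z)

/-- The generator `x_{ij}` of `L(m,n)` (0-indexed). -/
noncomputable def xg (K : Type) [Field K] {m n : ℕ} (i : Fin m) (j : Fin n) : Leavitt K m n :=
  lgen K (Sum.inl (i, j))

/-- The generator `y_{ji}` of `L(m,n)` (0-indexed). -/
noncomputable def yg (K : Type) [Field K] {m n : ℕ} (j : Fin n) (i : Fin m) : Leavitt K m n :=
  lgen K (Sum.inr (j, i))

/-- A word over the generating set `X` of `L(m,n)`. -/
abbrev LWord (m n : ℕ) := List (LGen m n)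

/-- The image of a word in `L(m,n)` (product of the images of its letters). -/
noncomputable def wordToL (K : Type) [Field K] {m n : ℕ} (w : LWord m n) : Leavitt K m n :=
  (w.map (lgen K)).prod

/-- A word is balanced if it has equally many x-letters and y-letters. -/
def LWord.Balanced {m n : ℕ} (w : LWord m n) : Prop :=
  w.countP Sum.isLeft = w.countP Sum.isRight

/-- The degree of a word: number of x-letters minus number of y-letters. -/
def LWord.degree {m n : ℕ} (w : LWord m n) : ℤ :=
  (w.countP Sum.isLeft : ℤ) - (w.countP Sum.isRight : ℤ)

/-- The `k`-component of the canonical grading of `L(m,n)`: the `K`-linear span of the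
images of all words of degree `k`. -/
noncomputable def Lcomponent (K : Type) [Field K] (m n : ℕ) (k : ℤ) :
    Submodule K (Leavitt K m n) :=
  Submodule.span K {a | ∃ w : LWord m n, w.degree = k ∧ wordToL K w = a}

/-- A pair of consecutive letters is forbidden if it is of the form `x_{in} y_{ni'}` or
`y_{jm} x_{mj'}` (the second index of the first letter being maximal). -/
def LForbidden {m n : ℕ} (z z' : LGen m n) : Prop :=
  (∃ (i i' : Fin m) (j : Fin n), (j : ℕ) = n - 1 ∧ z = Sum.inl (i, j) ∧ z' = Sum.inr (j, i')) ∨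
  (∃ (j j' : Fin n) (i : Fin m), (i : ℕ) = m - 1 ∧ z = Sum.inr (j, i) ∧ z' = Sum.inl (i, j'))

/-- A word is irreducible if it contains no forbidden subword `x_{in} y_{ni'}` or
`y_{jm} x_{mj'}`. -/
def LWord.Irr {m n : ℕ} (w : LWord m n) : Prop :=
  ∀ (u v : LWord m n) (z z' : LGen m n), w = u ++ z :: z' :: v → ¬ LForbidden z z'

/-- A nonempty balanced word is prime if it is not the concatenation of two nonempty
balanced words. -/
def LWord.IsPrime {m n : ℕ} (w : LWord m n) : Prop :=
  w ≠ [] ∧ w.Balanced ∧ ∀ u v : LWord m n, w = u ++ v → u ≠ [] → v ≠ [] → ¬ u.Balanced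

/-- An xy word: a nonempty balanced word whose first letter is an x-letter and whose
last letter is a y-letter. -/
def LWord.XY {m n : ℕ} (w : LWord m n) : Prop :=
  w.Balanced ∧ (∃ p, w.head? = some (Sum.inl p)) ∧ (∃ q, w.getLast? = some (Sum.inr q))

/-- A yx word: a nonempty balanced word whose first letter is a y-letter and whose
last letter is an x-letter. -/
def LWord.YX {m n : ℕ} (w : LWord m n) : Prop :=
  w.Balanced ∧ (∃ q, w.head? = some (Sum.inr q)) ∧ (∃ p, w.getLast? = some (Sum.inl p))

/-- Membership in the submonoid `⟨X⟩₀^{xy}` of `⟨X⟩₀` generated by the prime xy words. -/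
def LWord.InXY {m n : ℕ} (w : LWord m n) : Prop :=
  ∃ ws : List (LWord m n), (∀ u ∈ ws, u.IsPrime ∧ u.XY) ∧ ws.flatten = w

/-- Membership in the submonoid `⟨X⟩₀^{yx}` of `⟨X⟩₀` generated by the prime yx words. -/
def LWord.InYX {m n : ℕ} (w : LWord m n) : Prop :=
  ∃ ws : List (LWord m n), (∀ u ∈ ws, u.IsPrime ∧ u.YX) ∧ ws.flatten = w

/-- The subalgebra `L(m,n)₀^{xy}` of `L(m,n)` generated by images of all prime xy words. -/
noncomputable def L0xy (K : Type) [Field K] (m n : ℕ) : Subalgebra K (Leavitt K m n) :=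
  Algebra.adjoin K {a | ∃ w : LWord m n, w.IsPrime ∧ w.XY ∧ wordToL K w = a}

/-- The subalgebra `L(m,n)₀^{yx}` of `L(m,n)` generated by images of all prime yx words. -/
noncomputable def L0yx (K : Type) [Field K] (m n : ℕ) : Subalgebra K (Leavitt K m n) :=
  Algebra.adjoin K {a | ∃ w : LWord m n, w.IsPrime ∧ w.YX ∧ wordToL K w = a}

/-- The zero component `L(m,n)₀`, as a subalgebra: it is generated (indeed spanned)
by the images of all balanced words. -/
noncomputable def L0 (K : Type) [Field K] (m n : ℕ) : Subalgebra K (Leavitt K m n) :=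
  Algebra.adjoin K {a | ∃ w : LWord m n, w.Balanced ∧ wordToL K w = a}

/-- The letter `y_{1m}` (0-indexed: `y` with indices `j = 1`, `i = m`). -/
def y1mLetter {m n : ℕ} (hm : 0 < m) (hn : 0 < n) : LGen m n :=
  Sum.inr (⟨0, hn⟩, ⟨m - 1, by omega⟩)

/-- The letter `x_{m1}` (0-indexed: `x` with indices `i = m`, `j = 1`). -/
def xm1Letter {m n : ℕ} (hm : 0 < m) (hn : 0 < n) : LGen m n :=
  Sum.inl (⟨m - 1, by omega⟩, ⟨0, hn⟩)

/-- `BxyData p k Xb Yb r w` : the word `w` lies in `B^{xy}(k 1, …, k p)`, witnessed by its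
block decomposition `w = Xb 1 ++ Yb 1 ++ Xb 2 ++ Yb 2 ++ ⋯ ++ Xb p ++ Yb p`, where
`Xb i` is an x-block of length `k i − r (i−1)` and `Yb i` a y-block of length `k i − r i`,
with `r 0 = r p = 0` and `0 ≤ r i < min (k i) (k (i+1))` for `1 ≤ i ≤ p−1`; moreover `w`
is irreducible and lies in `⟨X⟩₀^{xy}`. -/
def BxyData {m n : ℕ} (p : ℕ) (k : ℕ → ℕ) (Xb Yb : ℕ → LWord m n) (r : ℕ → ℕ)
    (w : LWord m n) : Prop :=
  1 ≤ p ∧ (∀ i, 1 ≤ i → i ≤ p → 1 ≤ k i) ∧ r 0 = 0 ∧ r p = 0 ∧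
  (∀ i, 1 ≤ i → i ≤ p - 1 → r i < min (k i) (k (i + 1))) ∧
  (∀ i, 1 ≤ i → i ≤ p →
    (∀ z ∈ Xb i, z.isLeft = true) ∧ (Xb i).length = k i - r (i - 1) ∧
    (∀ z ∈ Yb i, z.isRight = true) ∧ (Yb i).length = k i - r i) ∧
  w = ((List.range p).map fun i => Xb (i + 1) ++ Yb (i + 1)).flatten ∧
  w.Irr ∧ w.InXY

/-- `w ∈ B^{xy}(k 1, …, k p)`. -/
def BxyMem {m n : ℕ} (p : ℕ) (k : ℕ → ℕ) (w : LWord m n) : Prop :=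
  ∃ Xb Yb r, BxyData p k Xb Yb r w

/-- The completion `ŵ` of a word of `B^{xy}(k 1, …, k p)` with block data `Xb, Yb, r` :
the word `(y_{1m})^{r i} (x_{m1})^{r i}` is inserted after the `i`-th y-block
(for `i < p`; note `r p = 0`, so nothing is inserted at the end). -/
def completionOf {m n : ℕ} (hm : 0 < m) (hn : 0 < n) (p : ℕ)
    (Xb Yb : ℕ → LWord m n) (r : ℕ → ℕ) : LWord m n :=
  ((List.range p).map fun i =>
    Xb (i + 1) ++ Yb (i + 1) ++
      (List.replicate (r (i + 1)) (y1mLetter hm hn) ++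
       List.replicate (r (i + 1)) (xm1Letter hm hn))).flatten

/-! ### Words whose prefixes never contain more y-letters than x-letters -/

/-- No prefix of `w` has more y-letters than x-letters, and `w` has `h` more x-letters than
y-letters. -/
def LWord.Nonneg {m n : ℕ} (h : ℕ) (w : LWord m n) : Prop :=
  (∀ u, u <+: w → u.countP Sum.isRight ≤ u.countP Sum.isLeft) ∧
    w.countP Sum.isLeft = w.countP Sum.isRight + h

theorem LWord.nonneg_nil {m n : ℕ} : LWord.Nonneg 0 ([] : LWord m n) := by
  constructor
  · intro u hu
    rw [List.prefix_nil.mp hu]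
    simp
  · simp

theorem LWord.Nonneg.append_left {m n : ℕ} {h : ℕ} {w A : LWord m n} (hw : w.Nonneg h)
    (hA : ∀ z ∈ A, z.isLeft = true) : LWord.Nonneg (h + A.length) (w ++ A) := by
  induction A generalizing h w with
  | nil => simpa using hw
  | cons a A ih =>
    have ha : a.isLeft = true := hA a (by simp)
    have ha' : a.isRight = false := by cases a <;> simp_all
    have : LWord.Nonneg (h + 1) (w ++ [a]) := by
      refine ⟨fun u hu => ?_, ?_⟩
      · rcases List.prefix_concat_iff.mp hu with rfl | hu
        · have := hw.2
          simp [ha, ha']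
          omega
        · exact hw.1 u hu
      · have := hw.2
        simp [ha, ha']
        omega
    have := ih this fun z hz => hA z (by simp [hz])
    simpa [add_assoc, add_comm 1] using this

theorem LWord.Nonneg.append_right {m n : ℕ} {h : ℕ} {w A : LWord m n}
    (hw : w.Nonneg (h + A.length)) (hA : ∀ z ∈ A, z.isRight = true) :
    LWord.Nonneg h (w ++ A) := by
  induction A generalizing w with
  | nil => simpa using hw
  | cons a A ih =>
    have ha : a.isRight = true := hA a (by simp)
    have ha' : a.isLeft = false := by cases a <;> simp_all
    have : LWord.Nonneg (h + A.length) (w ++ [a]) := by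
      have h2 := hw.2
      simp only [List.length_cons] at h2
      refine ⟨fun u hu => ?_, ?_⟩
      · rcases List.prefix_concat_iff.mp hu with rfl | hu
        · simp [ha, ha']
          omega
        · exact hw.1 u hu
      · simp [ha, ha']
        omega
    simpa using ih this fun z hz => hA z (by simp [hz])

theorem LWord.Nonneg.inXY {m n : ℕ} {w : LWord m n} (hw : w.Nonneg 0) : w.InXY := by
  induction hN : w.length using Nat.strong_induction_on generalizing w with
  | _ N ih =>
  subst hN
  rcases eq_or_ne w [] with rfl | hne
  · exact ⟨[], by simp, rfl⟩
  have hex : ∃ l, 0 < l ∧ l ≤ w.length ∧ LWord.Balanced (w.take l) :=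
    ⟨w.length, List.length_pos_iff.mpr hne, le_rfl, by
      simpa [LWord.Balanced] using hw.2⟩
  classical
  obtain ⟨hl0, hlw, hbal⟩ := Nat.find_spec hex
  have hmin := fun k => @Nat.find_min _ _ hex k
  generalize Nat.find hex = l at hl0 hlw hbal hmin
  obtain ⟨u, v, rfl, rfl⟩ : ∃ u v, w = u ++ v ∧ u.length = l :=
    ⟨w.take l, w.drop l, by simp, by simpa using hlw⟩
  rw [List.take_left] at hbal
  have hu0 : u ≠ [] := List.length_pos_iff.mp hl0
  have hprime : LWord.IsPrime u := by
    refine ⟨hu0, hbal, ?_⟩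
    rintro a b rfl ha hb hab
    have hb' := List.length_pos_iff.mpr hb
    refine hmin a.length (by simp only [List.length_append]; omega)
      ⟨List.length_pos_iff.mpr ha, by simp only [List.length_append]; omega, ?_⟩
    rw [List.append_assoc, List.take_left]
    exact hab
  have hxy : LWord.XY u := by
    refine ⟨hbal, ?_, ?_⟩
    · cases u with
      | nil => exact absurd rfl hu0
      | cons a u =>
        cases a with
        | inl q => exact ⟨q, rfl⟩
        | inr q => simpa using hw.1 [Sum.inr q] ⟨u ++ v, by simp⟩
    · obtain ⟨u', a, rfl⟩ := List.eq_nil_or_concat' u |>.resolve_left hu0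
      cases a with
      | inr q => exact ⟨q, by simp⟩
      | inl q =>
        have := hw.1 u' ⟨[Sum.inl q] ++ v, by simp⟩
        simp [LWord.Balanced] at hbal
        omega
  have hv : LWord.Nonneg 0 v := by
    constructor
    · intro t ht
      have := hw.1 (u ++ t) ((List.prefix_append_right_inj u).mpr ht)
      simp only [LWord.Balanced, List.countP_append] at hbal this
      omega
    · have := hw.2
      simp only [LWord.Balanced, List.countP_append] at hbal this
      omega
  obtain ⟨ws, hws, rfl⟩ := ih v.length (by simp only [List.length_append]; omega) hv rfl
  exact ⟨u :: ws, by simpa [hprime, hxy] using hws, by simp⟩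

/-! ### Irreducibility of a word given by its blocks -/

theorem LWord.irr_iff_isChain {m n : ℕ} (w : LWord m n) :
    w.Irr ↔ w.IsChain fun a b => ¬ LForbidden a b := by
  rw [List.isChain_iff_forall_rel_of_append_cons_cons]
  exact ⟨fun h a b u v e => h u v a b e, fun h u v a b e => h e⟩

theorem isChain_of_forall_isLeft {m n : ℕ} {A : LWord m n} (hA : ∀ z ∈ A, z.isLeft = true) :
    A.IsChain fun a b => ¬ LForbidden a b := by
  apply List.Pairwise.isChain
  rw [List.pairwise_iff_forall_sublist]
  rintro a b hab (⟨i, i', j, -, rfl, rfl⟩ | ⟨j, j', i, -, rfl, rfl⟩)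
  · simpa using hA _ (hab.subset (by simp : Sum.inr (j, i') ∈ _))
  · simpa using hA _ (hab.subset (by simp : Sum.inr (j, i) ∈ _))

theorem isChain_of_forall_isRight {m n : ℕ} {A : LWord m n} (hA : ∀ z ∈ A, z.isRight = true) :
    A.IsChain fun a b => ¬ LForbidden a b := by
  apply List.Pairwise.isChain
  rw [List.pairwise_iff_forall_sublist]
  rintro a b hab (⟨i, i', j, -, rfl, rfl⟩ | ⟨j, j', i, -, rfl, rfl⟩)
  · simpa using hA _ (hab.subset (by simp : Sum.inl (i, j) ∈ _))
  · simpa using hA _ (hab.subset (by simp : Sum.inl (i, j') ∈ _))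

/-- No forbidden pair arises where `A` and `B` meet in `A ++ B`. -/
def JunctionIrr {m n : ℕ} (A B : LWord m n) : Prop :=
  ∀ a ∈ A.getLast?, ∀ b ∈ B.head?, ¬ LForbidden a b

theorem irr_flatten_blocks_iff {m n : ℕ} {p : ℕ} {Xb Yb : ℕ → LWord m n}
    (hX : ∀ i < p, Xb (i + 1) ≠ [] ∧ ∀ z ∈ Xb (i + 1), z.isLeft = true)
    (hY : ∀ i < p, Yb (i + 1) ≠ [] ∧ ∀ z ∈ Yb (i + 1), z.isRight = true) :
    LWord.Irr ((List.range p).map fun i => Xb (i + 1) ++ Yb (i + 1)).flatten ↔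
      (∀ i < p, JunctionIrr (Xb (i + 1)) (Yb (i + 1))) ∧
        ∀ i < p - 1, JunctionIrr (Yb (i + 1)) (Xb (i + 2)) := by
  rw [LWord.irr_iff_isChain, List.isChain_flatten, List.isChain_map, List.isChain_range]
  · refine and_congr ?_ ?_
    · simp only [List.mem_map, List.mem_range, forall_exists_index, and_imp,
        forall_apply_eq_imp_iff₂]
      refine forall₂_congr fun i hi => ?_
      rw [List.isChain_append]
      exact ⟨fun h => h.2.2, fun h => ⟨isChain_of_forall_isLeft (hX i hi).2,
        isChain_of_forall_isRight (hY i hi).2, h⟩⟩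
    · refine forall₂_congr fun i hi => ?_
      rw [List.getLast?_append_of_ne_nil _ (hY i (by omega)).1,
        List.head?_append_of_ne_nil _ (hX (i + 1) (by omega)).1]
      rfl
  · simp only [List.mem_map, List.mem_range, not_exists, not_and]
    intro i hi h
    exact (hX i hi).1 (List.append_eq_nil_iff.mp h).1

/-! ### Filling the gaps between consecutive blocks -/

/-- The word obtained from the first `p` blocks by inserting the word `(c i).1 ++ (c i).2` after
the `i`-th y-block. -/
def fillGaps {m n : ℕ} (Xb Yb : ℕ → LWord m n) (c : ℕ → LWord m n × LWord m n) (p : ℕ) :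
    LWord m n :=
  ((List.range p).map fun i => Xb (i + 1) ++ Yb (i + 1) ++ ((c (i + 1)).1 ++ (c (i + 1)).2)).flatten

theorem fillGaps_succ {m n : ℕ} (Xb Yb : ℕ → LWord m n) (c : ℕ → LWord m n × LWord m n)
    (p : ℕ) : fillGaps Xb Yb c (p + 1) = fillGaps Xb Yb c p ++
      (Xb (p + 1) ++ Yb (p + 1) ++ ((c (p + 1)).1 ++ (c (p + 1)).2)) := by
  simp [fillGaps, List.range_succ]

theorem fillGaps_congr {m n : ℕ} (Xb Yb : ℕ → LWord m n) {c c' : ℕ → LWord m n × LWord m n}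
    {p : ℕ} (h : ∀ i ≤ p, c i = c' i) : fillGaps Xb Yb c p = fillGaps Xb Yb c' p := by
  unfold fillGaps
  congr 1
  refine List.map_congr_left fun i hi => ?_
  rw [h (i + 1) (List.mem_range.mp hi)]

/-- Assigning the inserted letters to the adjacent blocks. -/
theorem append_fillGaps {m n : ℕ} (Xb Yb : ℕ → LWord m n) (c : ℕ → LWord m n × LWord m n)
    (p : ℕ) : (c 0).2 ++ fillGaps Xb Yb c p =
      ((List.range p).map fun i =>
        ((c i).2 ++ Xb (i + 1)) ++ (Yb (i + 1) ++ (c (i + 1)).1)).flatten ++ (c p).2 := by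
  induction p with
  | zero => simp [fillGaps]
  | succ p ih =>
    rw [fillGaps_succ, ← List.append_assoc, ih]
    simp [List.range_succ]

/-- The pairs `(y_{1m}^s y_{1a}, x_{a1} x_{m1}^s)` with `s < r` and `a ≠ m`, and the empty pair. -/
def GapFilling {m n : ℕ} (hm : 0 < m) (hn : 0 < n) (r : ℕ) (c : LWord m n × LWord m n) : Prop :=
  c = ([], []) ∨ ∃ (s : ℕ) (a : Fin m), s < r ∧ (a : ℕ) ≠ m - 1 ∧
    c = (List.replicate s (y1mLetter hm hn) ++ [Sum.inr (⟨0, hn⟩, a)],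
      Sum.inl (a, ⟨0, hn⟩) :: List.replicate s (xm1Letter hm hn))

theorem GapFilling.mono {m n : ℕ} {hm : 0 < m} {hn : 0 < n} {r r' : ℕ}
    {c : LWord m n × LWord m n} (hc : GapFilling hm hn r c) (h : r ≤ r') :
    GapFilling hm hn r' c := by
  rcases hc with hc | ⟨s, a, hs, ha, hc⟩
  · exact Or.inl hc
  · exact Or.inr ⟨s, a, hs.trans_le h, ha, hc⟩

theorem GapFilling.eq_nil {m n : ℕ} {hm : 0 < m} {hn : 0 < n} {c : LWord m n × LWord m n}
    (hc : GapFilling hm hn 0 c) : c = ([], []) := by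
  rcases hc with hc | ⟨s, a, hs, -, -⟩
  · exact hc
  · omega

theorem GapFilling.forall_isRight {m n : ℕ} {hm : 0 < m} {hn : 0 < n} {r : ℕ}
    {c : LWord m n × LWord m n} (hc : GapFilling hm hn r c) :
    ∀ z ∈ c.1, z.isRight = true := by
  rcases hc with rfl | ⟨s, a, -, -, rfl⟩
  · simp
  · intro z hz
    rcases List.mem_append.mp hz with hz | hz
    · rw [List.eq_of_mem_replicate hz]
      rfl
    · rw [List.mem_singleton.mp hz]
      rfl

theorem GapFilling.forall_isLeft {m n : ℕ} {hm : 0 < m} {hn : 0 < n} {r : ℕ}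
    {c : LWord m n × LWord m n} (hc : GapFilling hm hn r c) :
    ∀ z ∈ c.2, z.isLeft = true := by
  rcases hc with rfl | ⟨s, a, -, -, rfl⟩
  · simp
  · intro z hz
    rcases List.mem_cons.mp hz with rfl | hz
    · rfl
    · rw [List.eq_of_mem_replicate hz]
      rfl

theorem GapFilling.length_eq {m n : ℕ} {hm : 0 < m} {hn : 0 < n} {r : ℕ}
    {c : LWord m n × LWord m n} (hc : GapFilling hm hn r c) : c.2.length = c.1.length := by
  rcases hc with rfl | ⟨s, a, -, -, rfl⟩ <;> simp

theorem GapFilling.length_le {m n : ℕ} {hm : 0 < m} {hn : 0 < n} {r : ℕ}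
    {c : LWord m n × LWord m n} (hc : GapFilling hm hn r c) : c.1.length ≤ r := by
  rcases hc with rfl | ⟨s, a, hs, -, rfl⟩
  · simp
  · simpa using hs

theorem GapFilling.junctionIrr {m n : ℕ} {hm : 0 < m} {hn : 0 < n} {r : ℕ}
    {c : LWord m n × LWord m n} (hc : GapFilling hm hn r c) {A B : LWord m n}
    (h : JunctionIrr A B) : JunctionIrr (A ++ c.1) (c.2 ++ B) := by
  rcases hc with rfl | ⟨s, a, -, ha, rfl⟩
  · simpa using h
  · intro z hz z' hz'
    simp only [← List.append_assoc, List.getLast?_concat, Option.mem_def, Option.some.injEq] at hz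
    simp only [List.cons_append, List.head?_cons, Option.mem_def, Option.some.injEq] at hz'
    subst hz hz'
    rintro (⟨i, i', j, -, h1, -⟩ | ⟨j, j', i, hi, h1, -⟩)
    · cases h1
    · cases h1
      exact ha hi

/-- Filling the gaps of a word of `B^{xy}(k 1, …, k p)` gives a word of the same set. -/
theorem BxyData.bxyMem_fillGaps {m n : ℕ} {hm : 0 < m} {hn : 0 < n} {p : ℕ} {k : ℕ → ℕ}
    {Xb Yb : ℕ → LWord m n} {r : ℕ → ℕ} {w : LWord m n} (hw : BxyData p k Xb Yb r w)
    {c : ℕ → LWord m n × LWord m n} (hc : ∀ i, GapFilling hm hn (r i) (c i)) :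
    BxyMem p k (fillGaps Xb Yb c p) := by
  obtain ⟨hp, hk, hr0, hrp, hr, hblk, rfl, hirr, -⟩ := hw
  have hc0 : c 0 = ([], []) := GapFilling.eq_nil (hr0 ▸ hc 0)
  have hcp : c p = ([], []) := GapFilling.eq_nil (hrp ▸ hc p)
  have hlt : ∀ i < p, r i < k (i + 1) ∧ r (i + 1) < k (i + 1) := by
    intro i hi
    have hk1 := hk (i + 1) (by omega) (by omega)
    constructor
    · rcases Nat.eq_zero_or_pos i with rfl | h
      · omega
      · exact (lt_min_iff.mp (hr i h (by omega))).2
    · rcases Nat.lt_or_ge (i + 1) p with h | h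
      · exact (lt_min_iff.mp (hr (i + 1) (by omega) (by omega))).1
      · have : i + 1 = p := by omega
        rw [this] at hk1 ⊢
        omega
  have hX : ∀ i < p, Xb (i + 1) ≠ [] ∧ ∀ z ∈ Xb (i + 1), z.isLeft = true := by
    intro i hi
    obtain ⟨h1, h2, -, -⟩ := hblk (i + 1) (by omega) (by omega)
    have := hlt i hi
    rw [Nat.add_sub_cancel] at h2
    exact ⟨List.length_pos_iff.mp (by omega), h1⟩
  have hY : ∀ i < p, Yb (i + 1) ≠ [] ∧ ∀ z ∈ Yb (i + 1), z.isRight = true := by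
    intro i hi
    obtain ⟨-, -, h1, h2⟩ := hblk (i + 1) (by omega) (by omega)
    have := hlt i hi
    exact ⟨List.length_pos_iff.mp (by omega), h1⟩
  have hflat := append_fillGaps Xb Yb c p
  simp only [hc0, hcp, List.nil_append, List.append_nil] at hflat
  have hX' : ∀ i < p, (c i).2 ++ Xb (i + 1) ≠ [] ∧
      ∀ z ∈ (c i).2 ++ Xb (i + 1), z.isLeft = true := by
    intro i hi
    refine ⟨by simp [(hX i hi).1], fun z hz => ?_⟩
    rcases List.mem_append.mp hz with hz | hz
    · exact (hc i).forall_isLeft z hz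
    · exact (hX i hi).2 z hz
  have hY' : ∀ i < p, Yb (i + 1) ++ (c (i + 1)).1 ≠ [] ∧
      ∀ z ∈ Yb (i + 1) ++ (c (i + 1)).1, z.isRight = true := by
    intro i hi
    refine ⟨by simp [(hY i hi).1], fun z hz => ?_⟩
    rcases List.mem_append.mp hz with hz | hz
    · exact (hY i hi).2 z hz
    · exact (hc (i + 1)).forall_isRight z hz
  have hlen : ∀ i < p,
      ((c i).2 ++ Xb (i + 1)).length = k (i + 1) - (r i - (c i).1.length) ∧
      (Yb (i + 1) ++ (c (i + 1)).1).length = k (i + 1) - (r (i + 1) - (c (i + 1)).1.length) := by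
    intro i hi
    obtain ⟨-, h2, -, h4⟩ := hblk (i + 1) (by omega) (by omega)
    have := hlt i hi
    have := (hc i).length_eq
    have := (hc i).length_le
    have := (hc (i + 1)).length_le
    rw [Nat.add_sub_cancel] at h2
    simp only [List.length_append]
    omega
  have hnonneg : ∀ q ≤ p, LWord.Nonneg (r q - (c q).1.length) ((List.range q).map fun i =>
      ((c i).2 ++ Xb (i + 1)) ++ (Yb (i + 1) ++ (c (i + 1)).1)).flatten := by
    intro q hq
    induction q with
    | zero => simpa [hr0] using LWord.nonneg_nil
    | succ q ih =>
      have h1 := (ih (by omega)).append_left (hX' q hq).2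
      obtain ⟨h2, h3⟩ := hlen q hq
      have h4 := hlt q hq
      have h5 : (r q - (c q).1.length) + ((c q).2 ++ Xb (q + 1)).length =
          (r (q + 1) - (c (q + 1)).1.length) + (Yb (q + 1) ++ (c (q + 1)).1).length := by
        omega
      rw [h5] at h1
      simpa [List.range_succ] using h1.append_right (hY' q hq).2
  refine ⟨fun i => (c (i - 1)).2 ++ Xb i, fun i => Yb i ++ (c i).1,
    fun i => r i - (c i).1.length, hp, hk, by simp [hr0], by simp [hrp], ?_, ?_, ?_, ?_, ?_⟩
  · intro i h1 h2
    exact (Nat.sub_le _ _).trans_lt (hr i h1 h2)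
  · intro i h1 h2
    obtain ⟨i, rfl⟩ := Nat.exists_eq_add_of_le' h1
    exact ⟨(hX' i h2).2, (hlen i h2).1, (hY' i h2).2, (hlen i h2).2⟩
  · simpa using hflat
  · rw [hflat]
    refine (irr_flatten_blocks_iff (Xb := fun i => (c (i - 1)).2 ++ Xb i)
      (Yb := fun i => Yb i ++ (c i).1) hX' hY').mpr ?_
    obtain ⟨h1, h2⟩ := (irr_flatten_blocks_iff hX hY).mp hirr
    refine ⟨fun i hi => ?_, fun i hi => (hc (i + 1)).junctionIrr (h2 i hi)⟩
    intro a ha b hb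
    rw [List.getLast?_append_of_ne_nil _ (hX i hi).1] at ha
    rw [List.head?_append_of_ne_nil _ (hY i hi).1] at hb
    exact h1 i hi a ha b hb
  · rw [hflat]
    have := hnonneg p le_rfl
    rw [hrp, Nat.zero_sub] at this
    exact this.inXY

/-! ### Expansion of the completion -/

theorem wordToL_append (K : Type) [Field K] {m n : ℕ} (u v : LWord m n) :
    wordToL K (u ++ v) = wordToL K u * wordToL K v := by
  simp [wordToL]

theorem sum_lgen_yx (K : Type) [Field K] {m n : ℕ} (j j' : Fin n) :
    ∑ i : Fin m, (lgen K (Sum.inr (j, i)) * lgen K (Sum.inl (i, j')) : Leavitt K m n) =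
      if j = j' then 1 else 0 := by
  have := RingQuot.mkAlgHom_rel K (LRel.yx (K := K) (m := m) j j')
  simp only [map_sum, map_mul] at this
  rw [show (∑ i : Fin m, lgen K (Sum.inr (j, i)) * lgen K (Sum.inl (i, j'))) = _ from this]
  split_ifs <;> simp

theorem wordToL_gap_sub_one_mem_span (K : Type) [Field K] {m n : ℕ} (hm : 0 < m) (hn : 0 < n)
    (r : ℕ) :
    wordToL K (List.replicate r (y1mLetter hm hn) ++ List.replicate r (xm1Letter hm hn)) - 1 ∈
      Submodule.span K {a | ∃ c, GapFilling hm hn r c ∧ 0 < c.1.length ∧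
        wordToL K (c.1 ++ c.2) = a} := by
  induction r with
  | zero => simp [wordToL]
  | succ r ih =>
    set last : Fin m := ⟨m - 1, by omega⟩
    have hrel := sum_lgen_yx K (m := m) (⟨0, hn⟩ : Fin n) ⟨0, hn⟩
    rw [if_pos rfl, ← Finset.add_sum_erase _ _ (Finset.mem_univ last)] at hrel
    have hyx := eq_sub_of_add_eq hrel
    have hexp : wordToL K (List.replicate (r + 1) (y1mLetter hm hn) ++
          List.replicate (r + 1) (xm1Letter hm hn)) - 1 =
        (wordToL K (List.replicate r (y1mLetter hm hn) ++
          List.replicate r (xm1Letter hm hn)) - 1) -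
        ∑ a ∈ Finset.univ.erase last,
          wordToL K ((List.replicate r (y1mLetter hm hn) ++ [Sum.inr (⟨0, hn⟩, a)]) ++
            Sum.inl (a, ⟨0, hn⟩) :: List.replicate r (xm1Letter hm hn)) := by
      have h1 : ∀ a : Fin m,
          wordToL K ((List.replicate r (y1mLetter hm hn) ++ [Sum.inr (⟨0, hn⟩, a)]) ++
            Sum.inl (a, ⟨0, hn⟩) :: List.replicate r (xm1Letter hm hn)) =
          wordToL K (List.replicate r (y1mLetter hm hn)) *
            (lgen K (Sum.inr (⟨0, hn⟩, a)) * lgen K (Sum.inl (a, ⟨0, hn⟩))) *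
            wordToL K (List.replicate r (xm1Letter hm hn)) := by
        intro a
        simp [wordToL, mul_assoc]
      have h2 := h1 last
      rw [hyx] at h2
      rw [List.replicate_succ', List.replicate_succ]
      refine (congrArg (· - 1) h2).trans ?_
      simp only [h1, ← Finset.sum_mul, ← Finset.mul_sum, wordToL_append, mul_sub, sub_mul,
        mul_one]
      abel
    rw [hexp]
    refine Submodule.sub_mem _ ?_ (Submodule.sum_mem _ fun a ha => Submodule.subset_span ?_)
    · refine Submodule.span_mono ?_ ih
      rintro _ ⟨c, hc, hpos, rfl⟩
      exact ⟨c, hc.mono r.le_succ, hpos, rfl⟩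
    · refine ⟨_, Or.inr ⟨r, a, r.lt_succ_self, ?_, rfl⟩, by simp, rfl⟩
      intro h
      exact Finset.ne_of_mem_erase ha (Fin.ext h)

theorem wordToL_fillGaps_sub_mem_span (K : Type) [Field K] {m n : ℕ} (hm : 0 < m) (hn : 0 < n)
    (Xb Yb : ℕ → LWord m n) (r : ℕ → ℕ) (q : ℕ) :
    wordToL K (fillGaps Xb Yb (fun i => (List.replicate (r i) (y1mLetter hm hn),
        List.replicate (r i) (xm1Letter hm hn))) q) -
      wordToL K (fillGaps Xb Yb (fun _ => ([], [])) q) ∈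
      Submodule.span K {a | ∃ c, (∀ i, GapFilling hm hn (r i) (c i)) ∧
        (fillGaps Xb Yb (fun _ => ([], [])) q).length < (fillGaps Xb Yb c q).length ∧
        wordToL K (fillGaps Xb Yb c q) = a} := by
  classical
  induction q with
  | zero => simp [fillGaps]
  | succ q ih =>
    set F := wordToL K (fillGaps Xb Yb (fun i => (List.replicate (r i) (y1mLetter hm hn),
        List.replicate (r i) (xm1Letter hm hn))) q) with hF
    set W := wordToL K (fillGaps Xb Yb (fun _ => ([], [])) q) with hW
    set B := wordToL K (Xb (q + 1) ++ Yb (q + 1)) with hB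
    have hgap := wordToL_gap_sub_one_mem_span K hm hn (r (q + 1))
    set G := wordToL K (List.replicate (r (q + 1)) (y1mLetter hm hn) ++
      List.replicate (r (q + 1)) (xm1Letter hm hn)) with hG
    have hupd : ∀ (c : ℕ → LWord m n × LWord m n) d,
        fillGaps Xb Yb (Function.update c (q + 1) d) (q + 1) =
          fillGaps Xb Yb c q ++ (Xb (q + 1) ++ Yb (q + 1) ++ (d.1 ++ d.2)) := by
      intro c d
      rw [fillGaps_succ, Function.update_self, fillGaps_congr Xb Yb (c' := c)]
      intro i hi
      exact Function.update_of_ne (by omega) _ _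
    have hval : ∀ (c : ℕ → LWord m n × LWord m n) d, (∀ i, GapFilling hm hn (r i) (c i)) →
        GapFilling hm hn (r (q + 1)) d →
        ∀ i, GapFilling hm hn (r i) (Function.update c (q + 1) d i) := by
      intro c d hc hd i
      rcases eq_or_ne i (q + 1) with rfl | hi
      · simpa using hd
      · simpa [hi] using hc i
    set S := Submodule.span K {a | ∃ c, (∀ i, GapFilling hm hn (r i) (c i)) ∧
        (fillGaps Xb Yb (fun _ => ([], [])) (q + 1)).length <
          (fillGaps Xb Yb c (q + 1)).length ∧
        wordToL K (fillGaps Xb Yb c (q + 1)) = a}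
    have hmem : ∀ (c : ℕ → LWord m n × LWord m n) d, (∀ i, GapFilling hm hn (r i) (c i)) →
        GapFilling hm hn (r (q + 1)) d →
        (fillGaps Xb Yb (fun _ => ([], [])) q).length <
          (fillGaps Xb Yb c q).length + d.1.length →
        wordToL K (fillGaps Xb Yb c q) * B * wordToL K (d.1 ++ d.2) ∈ S := by
      intro c d hc hd hlt
      refine Submodule.subset_span ⟨_, hval c d hc hd, ?_, ?_⟩
      · rw [hupd, fillGaps_succ]
        simp only [List.length_append, List.length_nil]
        omega
      · rw [hupd, wordToL_append, wordToL_append K (_ ++ _), mul_assoc]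
    have hsplit : F * B * G - W * B =
        W * B * (G - 1) + (F - W) * B + (F - W) * B * (G - 1) := by
      simp only [mul_sub, sub_mul, mul_one]
      abel
    have hgoal : wordToL K (fillGaps Xb Yb (fun i => (List.replicate (r i) (y1mLetter hm hn),
        List.replicate (r i) (xm1Letter hm hn))) (q + 1)) -
        wordToL K (fillGaps Xb Yb (fun _ => ([], [])) (q + 1)) = F * B * G - W * B := by
      simp only [fillGaps_succ, List.append_nil, hF, hB, hG, hW, wordToL_append, mul_assoc]
    rw [hgoal, hsplit]
    clear hgoal hsplit
    generalize G - 1 = G' at hgap ⊢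
    generalize F - W = F' at ih ⊢
    refine Submodule.add_mem _ (Submodule.add_mem _ ?_ ?_) ?_
    · induction hgap using Submodule.span_induction with
      | mem _ h =>
        obtain ⟨d, hd, hpos, rfl⟩ := h
        exact hmem _ d (fun _ => Or.inl rfl) hd (by omega)
      | zero => simp
      | add a b _ _ ha hb => rw [mul_add]; exact S.add_mem ha hb
      | smul t a _ ha => rw [mul_smul_comm]; exact S.smul_mem t ha
    · induction ih using Submodule.span_induction with
      | mem _ h =>
        obtain ⟨c, hc, hlt, rfl⟩ := h
        simpa [wordToL] using hmem c ([], []) hc (Or.inl rfl) (by simpa using hlt)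
      | zero => simp
      | add a b _ _ ha hb => rw [add_mul]; exact S.add_mem ha hb
      | smul t a _ ha => rw [smul_mul_assoc]; exact S.smul_mem t ha
    · induction ih using Submodule.span_induction with
      | mem _ h =>
        obtain ⟨c, hc, hlt, rfl⟩ := h
        induction hgap using Submodule.span_induction with
        | mem _ h =>
          obtain ⟨d, hd, hpos, rfl⟩ := h
          exact hmem c d hc hd (by omega)
        | zero => simp
        | add a b _ _ ha hb => rw [mul_add]; exact S.add_mem ha hb
        | smul t a _ ha => rw [mul_smul_comm]; exact S.smul_mem t ha
      | zero => simp
      | add a b _ _ ha hb => rw [add_mul, add_mul]; exact S.add_mem ha hb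
      | smul t a _ ha => rw [smul_mul_assoc, smul_mul_assoc]; exact S.smul_mem t ha

/-- If `w ∈ B^{xy}(k 1, …, k p)` has completion `ŵ`, then in `L(m,n)`
one has `ŵ = w + c₁ w₁ + ⋯ + c_t w_t` for some scalars `c_s ∈ K` and words
`w_s ∈ B^{xy}(k 1, …, k p)` of length strictly greater than the length of `w`. -/
theorem stmt11 (K : Type) [Field K] (m n : ℕ) (hm : 0 < m) (hn : 0 < n)
    (p : ℕ) (k : ℕ → ℕ) (Xb Yb : ℕ → LWord m n) (r : ℕ → ℕ) (w : LWord m n)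
    (hw : BxyData p k Xb Yb r w) :
    ∃ (t : ℕ) (c : Fin t → K) (ws : Fin t → LWord m n),
      (∀ s, BxyMem p k (ws s) ∧ w.length < (ws s).length) ∧
      wordToL K (completionOf hm hn p Xb Yb r) =
        wordToL K w + ∑ s, c s • wordToL K (ws s) := by
  have hfill : fillGaps Xb Yb (fun _ => ([], [])) p = w := by
    rw [hw.2.2.2.2.2.2.1]
    simp [fillGaps]
  have hspan := wordToL_fillGaps_sub_mem_span K hm hn Xb Yb r p
  rw [hfill] at hspan
  obtain ⟨t, c, g, hg⟩ := Submodule.mem_span_set'.mp hspan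
  choose d hd hlt hval using fun s => (g s).2
  refine ⟨t, c, fun s => fillGaps Xb Yb (d s) p,
    fun s => ⟨hw.bxyMem_fillGaps (hd s), hlt s⟩, ?_⟩
  simp only [hval, hg]
  exact (add_sub_cancel _ _).symm
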